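/- Let c > d > 0 and let k be an even integer with k < 2c/d. Then the minimal partition energy of the torus T(c,d) satisfies 𝔏_k(T(c,d)) = π²k²/c², and it is attained by the nodal partition of the eigenfunction (x,y) ↦ sin(πkx/c), i.e. by the partition of T(c,d) into the k vertical strips ((i−1)c/k, ic/k) × (ℝ/dℤ), i = 1,…,k. -/

import Mathlib

open Real MeasureTheory Set

noncomputable section

/-- The flat torus `T(a,b) = (ℝ/aℤ) × (ℝ/bℤ)`. -/
abbrev Torus (a b : ℝ) := AddCircle a × AddCircle b

/-- The canonical projection `ℝ² → T(a,b)`. -/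
def torusProj (a b : ℝ) (p : ℝ × ℝ) : Torus a b :=
  ((p.1 : AddCircle a), (p.2 : AddCircle b))

/-- Squared Euclidean norm of the gradient of `f : ℝ² → ℝ` at `p`. -/
def gradSq (f : ℝ × ℝ → ℝ) (p : ℝ × ℝ) : ℝ :=
  (fderiv ℝ f p (1, 0)) ^ 2 + (fderiv ℝ f p (0, 1)) ^ 2

/-- A fundamental domain for the torus `T(a,b)` inside `ℝ²`. -/
def Fund (a b : ℝ) : Set (ℝ × ℝ) := Ioc 0 a ×ˢ Ioc 0 b

/-- The Rayleigh quotient `∫ |∇u|² / ∫ u²` of a function `u` on the torus `T(a,b)`,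
computed by lifting `u` to `ℝ²` and integrating over a fundamental domain. -/
def RayleighT (a b : ℝ) (u : Torus a b → ℝ) : ℝ :=
  (∫ p in Fund a b, gradSq (fun q => u (torusProj a b q)) p) /
    (∫ p in Fund a b, (u (torusProj a b p)) ^ 2)

/-- `u` is an admissible (test) function for the Dirichlet ground state energy of
`D ⊆ T(a,b)`: it is smooth (i.e. its lift to `ℝ²` is `C^∞`), nonzero, and its support is
a compact subset of `D`. -/
def IsTest (a b : ℝ) (D : Set (Torus a b)) (u : Torus a b → ℝ) : Prop :=
  ContDiff ℝ (⊤ : ℕ∞) (fun q : ℝ × ℝ => u (torusProj a b q)) ∧ u ≠ 0 ∧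
    IsCompact (tsupport u) ∧ tsupport u ⊆ D

/-- The ground state energy `λ(D)` of an open set `D ⊆ T(a,b)`:
the infimum of Rayleigh quotients over test functions supported in `D`. -/
def groundEnergy (a b : ℝ) (D : Set (Torus a b)) : ℝ :=
  sInf {r | ∃ u : Torus a b → ℝ, IsTest a b D u ∧ r = RayleighT a b u}

/-- A `k`-partition of the torus `T(a,b)`: a `k`-tuple of pairwise disjoint nonempty
open subsets. -/
def IsPartitionT (a b : ℝ) {k : ℕ} (D : Fin k → Set (Torus a b)) : Prop :=
  (∀ i, IsOpen (D i)) ∧ (∀ i, (D i).Nonempty) ∧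
    ∀ i j, i ≠ j → Disjoint (D i) (D j)

/-- The energy `Λ(𝒟) = max_j λ(D_j)` of a partition. -/
def energyT (a b : ℝ) {k : ℕ} (D : Fin k → Set (Torus a b)) : ℝ :=
  ⨆ i, groundEnergy a b (D i)

/-- The minimal partition energy `𝔏_k(T(a,b))`. -/
def minEnergyT (a b : ℝ) (k : ℕ) : ℝ :=
  sInf {E | ∃ D : Fin k → Set (Torus a b), IsPartitionT a b D ∧ E = energyT a b D}

/-- The partition of `T(c,d)` into the `k` vertical strips `((i-1)c/k, ic/k) × (ℝ/dℤ)`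
(indexed here by `i = 0, …, k-1`), i.e. the nodal partition of `(x,y) ↦ sin (πkx/c)`. -/
def stripPartitionCD (c d : ℝ) (k : ℕ) : Fin k → Set (Torus c d) :=
  fun i => {z : Torus c d | ∃ x : ℝ,
    (x : AddCircle c) = z.1 ∧ ((i : ℕ) : ℝ) * c / k < x ∧ x < (((i : ℕ) : ℝ) + 1) * c / k}


theorem fourierCoeffOn_eq_exp {T : ℝ} (hT : 0 < T) (f : ℝ → ℂ) (n : ℤ) :
    fourierCoeffOn hT f n =
      (1 / T : ℝ) • ∫ x in (0 : ℝ)..T, Complex.exp (-(2 * π * Complex.I * n * x / T)) * f x := by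
  rw [fourierCoeffOn_eq_integral]
  simp only [fourier_coe_apply, sub_zero, smul_eq_mul, Int.cast_neg]
  congr 2
  ext x
  congr 2
  ring

/-- Wirtinger's inequality for a periodic function without low Fourier modes. -/
theorem wirtinger_of_fourier_eq_zero {T : ℝ} (hT : 0 < T) {f f' : ℝ → ℝ}
    (hf : ∀ x, HasDerivAt f (f' x) x) (hf' : Continuous f') (hper : f T = f 0) (N : ℕ)
    (horth : ∀ n : ℕ, n < N →
      ∫ x in (0 : ℝ)..T, Complex.exp (-(2 * π * Complex.I * n * x / T)) * (f x : ℂ) = 0) :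
    (2 * π * N / T) ^ 2 * ∫ x in (0 : ℝ)..T, f x ^ 2 ≤ ∫ x in (0 : ℝ)..T, f' x ^ 2 := by
  have hcf : Continuous f := continuous_iff_continuousAt.2 fun x => (hf x).continuousAt
  have memLp : ∀ g : ℝ → ℝ, Continuous g →
      MemLp (fun x => (g x : ℂ)) 2 (volume.restrict (Ioc 0 T)) := fun g hg =>
    (memLp_two_iff_integrable_sq_norm
      (Complex.continuous_ofReal.comp hg).aestronglyMeasurable).2
      ((Complex.continuous_ofReal.comp hg).norm.pow 2).integrableOn_Ioc
  have parseval : ∀ g : ℝ → ℝ, Continuous g →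
      HasSum (fun n => ‖fourierCoeffOn hT (fun x => (g x : ℂ)) n‖ ^ 2)
        (T⁻¹ * ∫ x in (0 : ℝ)..T, g x ^ 2) := fun g hg => by
    simpa [Complex.norm_real] using hasSum_sq_fourierCoeffOn hT (memLp g hg)
  have low : ∀ n : ℤ, |n| < N → fourierCoeffOn hT (fun x => (f x : ℂ)) n = 0 := by
    intro n hn
    rw [fourierCoeffOn_eq_exp]
    rcases Int.eq_nat_or_neg n with ⟨m, rfl | rfl⟩
    · rw [show ((m : ℤ) : ℂ) = m by simp, horth m (by simpa using hn), smul_zero]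
    · have h := congrArg (starRingEnd ℂ) (horth m (by simpa using hn))
      rw [← intervalIntegral.intervalIntegral_conj] at h
      have : ∀ x : ℝ, Complex.exp (-(2 * π * Complex.I * ((-m : ℤ) : ℂ) * x / T)) * (f x : ℂ) =
          (starRingEnd ℂ) (Complex.exp (-(2 * π * Complex.I * m * x / T)) * (f x : ℂ)) := by
        intro x
        simp [← Complex.exp_conj, map_ofNat]
      simp only [this]
      rw [h]; simp
  have coeff : ∀ n : ℤ, (2 * π * N / T) ^ 2 * ‖fourierCoeffOn hT (fun x => (f x : ℂ)) n‖ ^ 2 ≤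
      ‖fourierCoeffOn hT (fun x => (f' x : ℂ)) n‖ ^ 2 := by
    intro n
    by_cases hn : |n| < N
    · rw [low n hn]; simp
    · by_cases hn0 : n = 0
      · have : N = 0 := by subst hn0; simpa using hn
        subst this; simp
      have key := fourierCoeffOn_of_hasDerivAt hT (n := n) hn0
        (fun x _ => (hf x).ofReal_comp) ((Complex.continuous_ofReal.comp hf').intervalIntegrable _ _)
      simp only [hper, sub_self, mul_zero, zero_sub] at key
      rw [key]
      have h1 : ‖1 / (-2 * π * Complex.I * n) * -(((T : ℂ) - (0 : ℝ)) * fourierCoeffOn hT (fun x => (f' x : ℂ)) n)‖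
          = T / (2 * π * |(n : ℝ)|) * ‖fourierCoeffOn hT (fun x => (f' x : ℂ)) n‖ := by
        simp [abs_of_pos hT, abs_of_pos pi_pos]
        ring
      rw [h1, mul_pow, ← mul_assoc, ← mul_pow]
      have hn' : (N : ℝ) ≤ |(n : ℝ)| := by
        rw [← Int.cast_abs]; exact_mod_cast not_lt.1 hn
      have hpos : 0 < |(n : ℝ)| := by positivity
      have : 2 * π * N / T * (T / (2 * π * |(n : ℝ)|)) = N / |(n : ℝ)| := by
        field_simp
      rw [this]
      refine mul_le_of_le_one_left (by positivity) (pow_le_one₀ (by positivity) ?_)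
      exact (div_le_one hpos).2 hn'
  have := hasSum_le coeff ((parseval f hcf).mul_left _) (parseval f' hf')
  have hT' : 0 < T⁻¹ := inv_pos.2 hT
  nlinarith [mul_le_mul_of_nonneg_left this hT.le, mul_inv_cancel₀ hT.ne']

theorem hasDerivAt_intervalIntegral_of_continuous {F F' : ℝ → ℝ → ℝ} (a b x₀ : ℝ)
    (hF : ∀ x, Continuous (F x)) (hF' : Continuous fun p : ℝ × ℝ => F' p.1 p.2)
    (h : ∀ x y, HasDerivAt (fun x => F x y) (F' x y) x) :
    HasDerivAt (fun x => ∫ y in a..b, F x y) (∫ y in a..b, F' x₀ y) x₀ := by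
  obtain ⟨C, hC⟩ := ((isCompact_Icc (a := x₀ - 1) (b := x₀ + 1)).prod
    (isCompact_uIcc (a := a) (b := b))).exists_bound_of_continuousOn hF'.continuousOn
  refine (intervalIntegral.hasDerivAt_integral_of_dominated_loc_of_deriv_le
    (s := Icc (x₀ - 1) (x₀ + 1)) (bound := fun _ => C)
    (Icc_mem_nhds (by linarith) (by linarith))
    (Filter.Eventually.of_forall fun x => (hF x).aestronglyMeasurable)
    ((hF x₀).intervalIntegrable _ _)
    (Continuous.aestronglyMeasurable (by fun_prop)) ?_ intervalIntegrable_const ?_).2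
  · exact Filter.Eventually.of_forall fun y hy x hx => hC (x, y) ⟨hx, uIoc_subset_uIcc hy⟩
  · exact Filter.Eventually.of_forall fun y _ x _ => h x y

/-- The mean square decomposes into the variance and the square of the mean. -/
theorem integral_sub_mean_sq {d : ℝ} (hd : 0 < d) {g : ℝ → ℝ} (hg : Continuous g) :
    ∫ y in (0 : ℝ)..d, (g y - d⁻¹ * ∫ t in (0 : ℝ)..d, g t) ^ 2 =
      (∫ y in (0 : ℝ)..d, g y ^ 2) - d * (d⁻¹ * ∫ t in (0 : ℝ)..d, g t) ^ 2 := by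
  set m := d⁻¹ * ∫ t in (0 : ℝ)..d, g t with hm
  have hI : ∫ t in (0 : ℝ)..d, g t = d * m := by rw [hm]; field_simp
  have : ∀ y, (g y - m) ^ 2 = g y ^ 2 - (2 * m) * g y + m ^ 2 := fun y => by ring
  simp only [this]
  rw [intervalIntegral.integral_add, intervalIntegral.integral_sub,
    intervalIntegral.integral_const_mul, hI, intervalIntegral.integral_const]
  · simp; ring
  all_goals exact Continuous.intervalIntegrable (by fun_prop) _ _

/-- Poincaré's inequality for a smooth doubly periodic function orthogonal to the low modes in
the first variable. -/
theorem poincare_of_fourier_eq_zero {c d : ℝ} (hc : 0 < c) (hd : 0 < d) {N : ℕ}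
    (hN : (N : ℝ) / c ≤ 1 / d) {V Vx Vy : ℝ × ℝ → ℝ}
    (hVx : ∀ x y, HasDerivAt (fun s => V (s, y)) (Vx (x, y)) x)
    (hVy : ∀ x y, HasDerivAt (fun s => V (x, s)) (Vy (x, y)) y)
    (hV : Continuous V) (hVx' : Continuous Vx) (hVy' : Continuous Vy)
    (hperx : ∀ y, V (c, y) = V (0, y)) (hpery : ∀ x, V (x, d) = V (x, 0))
    (horth : ∀ n : ℕ, n < N → ∫ x in (0 : ℝ)..c,
      Complex.exp (-(2 * π * Complex.I * n * x / c)) * ((∫ y in (0 : ℝ)..d, V (x, y) : ℝ) : ℂ)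
        = 0) :
    (2 * π * N / c) ^ 2 * ∫ x in (0 : ℝ)..c, ∫ y in (0 : ℝ)..d, V (x, y) ^ 2 ≤
      ∫ x in (0 : ℝ)..c, ∫ y in (0 : ℝ)..d, (Vx (x, y) ^ 2 + Vy (x, y) ^ 2) := by
  set m : ℝ → ℝ := fun x => d⁻¹ * ∫ y in (0 : ℝ)..d, V (x, y) with hm
  set m' : ℝ → ℝ := fun x => d⁻¹ * ∫ y in (0 : ℝ)..d, Vx (x, y) with hm'
  have hmd : ∀ x, HasDerivAt m (m' x) x := fun x =>
    (hasDerivAt_intervalIntegral_of_continuous 0 d x (F := fun x y => V (x, y))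
      (F' := fun x y => Vx (x, y)) (fun x => by fun_prop) hVx' hVx).const_mul _
  have hmc : Continuous m := continuous_iff_continuousAt.2 fun x => (hmd x).continuousAt
  have cont : ∀ g : ℝ × ℝ → ℝ, Continuous g →
      Continuous fun x => ∫ y in (0 : ℝ)..d, g (x, y) := fun g hg =>
    intervalIntegral.continuous_parametric_intervalIntegral_of_continuous' (by simpa using! hg) _ _
  have hmc' : Continuous m' := (cont Vx hVx').const_mul _
  have mean := wirtinger_of_fourier_eq_zero hc hmd hmc' (by simp [hm, hperx]) N fun n hn => by
    have := horth n hn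
    calc _ = ∫ x in (0 : ℝ)..c, ((d⁻¹ : ℝ) : ℂ) * (Complex.exp (-(2 * π * Complex.I * n * x / c)) *
          ((∫ y in (0 : ℝ)..d, V (x, y) : ℝ) : ℂ)) := by
          congr 1; ext x; simp only [hm, Complex.ofReal_mul]; ring
      _ = 0 := by rw [intervalIntegral.integral_const_mul, this, mul_zero]
  set μ := (2 * π * N / c) ^ 2 with hμ
  have hμd : μ ≤ (2 * π * (1 : ℕ) / d) ^ 2 := by
    refine pow_le_pow_left₀ (by positivity) ?_ 2
    rw [mul_div_assoc, mul_div_assoc]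
    exact mul_le_mul_of_nonneg_left (by simpa using hN) (by positivity)
  have fiber : ∀ x, μ * ∫ y in (0 : ℝ)..d, V (x, y) ^ 2 ≤
      (∫ y in (0 : ℝ)..d, Vy (x, y) ^ 2) + μ * (d * m x ^ 2) := by
    intro x
    have hw := wirtinger_of_fourier_eq_zero hd (f := fun y => V (x, y) - m x)
      (f' := fun y => Vy (x, y)) (fun y => (hVy x y).sub_const _) (by fun_prop)
      (by simp [hpery]) 1 fun n hn => by
        obtain rfl : n = 0 := by omega
        simp only [CharP.cast_eq_zero, mul_zero, zero_mul, zero_div, neg_zero, Complex.exp_zero,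
          one_mul]
        rw [intervalIntegral.integral_ofReal, intervalIntegral.integral_sub
          (Continuous.intervalIntegrable (by fun_prop) _ _) intervalIntegrable_const]
        simp only [hm, intervalIntegral.integral_const]
        simp [hd.ne']
    have hs := integral_sub_mean_sq hd (g := fun y => V (x, y)) (by fun_prop)
    have hnn : 0 ≤ ∫ y in (0 : ℝ)..d, (V (x, y) - m x) ^ 2 :=
      intervalIntegral.integral_nonneg hd.le fun _ _ => sq_nonneg _
    have := mul_le_mul_of_nonneg_right hμd hnn
    have hs' : ∫ y in (0 : ℝ)..d, V (x, y) ^ 2 =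
      (∫ y in (0 : ℝ)..d, (V (x, y) - m x) ^ 2) + d * m x ^ 2 := by
      simp only [hm]; rw [hs]; ring
    rw [hs', mul_add]
    linarith
  have fiber' : ∀ x, d * m' x ^ 2 ≤ ∫ y in (0 : ℝ)..d, Vx (x, y) ^ 2 := by
    intro x
    have hs := integral_sub_mean_sq hd (g := fun y => Vx (x, y)) (by fun_prop)
    have hnn : 0 ≤ ∫ y in (0 : ℝ)..d, (Vx (x, y) - m' x) ^ 2 :=
      intervalIntegral.integral_nonneg hd.le fun _ _ => sq_nonneg _
    simp only [hm'] at hnn ⊢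
    linarith
  have cV := cont (fun p => V p ^ 2) (by fun_prop)
  have cx := cont (fun p => Vx p ^ 2) (by fun_prop)
  have cy := cont (fun p => Vy p ^ 2) (by fun_prop)
  calc _ = ∫ x in (0 : ℝ)..c, μ * ∫ y in (0 : ℝ)..d, V (x, y) ^ 2 := by
        rw [intervalIntegral.integral_const_mul]
    _ ≤ ∫ x in (0 : ℝ)..c, ((∫ y in (0 : ℝ)..d, Vy (x, y) ^ 2) + μ * (d * m x ^ 2)) :=
        intervalIntegral.integral_mono_on hc.le ((cV.const_mul _).intervalIntegrable _ _)
          (Continuous.intervalIntegrable (by fun_prop) _ _) fun x _ => fiber x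
    _ = (∫ x in (0 : ℝ)..c, ∫ y in (0 : ℝ)..d, Vy (x, y) ^ 2) +
          d * (μ * ∫ x in (0 : ℝ)..c, m x ^ 2) := by
        rw [intervalIntegral.integral_add (cy.intervalIntegrable _ _)
          (Continuous.intervalIntegrable (by fun_prop) _ _)]
        simp only [intervalIntegral.integral_const_mul]; ring
    _ ≤ (∫ x in (0 : ℝ)..c, ∫ y in (0 : ℝ)..d, Vy (x, y) ^ 2) +
          d * ∫ x in (0 : ℝ)..c, m' x ^ 2 := by gcongr
    _ = (∫ x in (0 : ℝ)..c, ∫ y in (0 : ℝ)..d, Vy (x, y) ^ 2) +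
          ∫ x in (0 : ℝ)..c, d * m' x ^ 2 := by rw [intervalIntegral.integral_const_mul]
    _ ≤ (∫ x in (0 : ℝ)..c, ∫ y in (0 : ℝ)..d, Vy (x, y) ^ 2) +
          ∫ x in (0 : ℝ)..c, ∫ y in (0 : ℝ)..d, Vx (x, y) ^ 2 := by
        gcongr
        exact intervalIntegral.integral_mono_on hc.le
          (Continuous.intervalIntegrable (by fun_prop) _ _) (cx.intervalIntegrable _ _)
          fun x _ => fiber' x
    _ = _ := by
        rw [add_comm, ← intervalIntegral.integral_add (cx.intervalIntegrable _ _)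
          (cy.intervalIntegrable _ _)]
        congr 1; ext x
        rw [intervalIntegral.integral_add] <;>
          exact Continuous.intervalIntegrable (by fun_prop) _ _

theorem integral_Fund_eq {c d : ℝ} (hc : 0 ≤ c) (hd : 0 ≤ d) {g : ℝ × ℝ → ℝ}
    (hg : Continuous g) :
    ∫ p in Fund c d, g p = ∫ x in (0 : ℝ)..c, ∫ y in (0 : ℝ)..d, g (x, y) := by
  rw [Fund, Measure.volume_eq_prod, setIntegral_prod]
  · simp only [intervalIntegral.integral_of_le hc, intervalIntegral.integral_of_le hd]
  · exact (hg.continuousOn.integrableOn_compact (isCompact_Icc.prod isCompact_Icc)).mono_set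
      (prod_mono Ioc_subset_Icc_self Ioc_subset_Icc_self)

theorem integrableOn_Fund {c d : ℝ} {g : ℝ × ℝ → ℝ} (hg : Continuous g) :
    IntegrableOn g (Fund c d) :=
  (hg.continuousOn.integrableOn_compact (isCompact_Icc.prod isCompact_Icc)).mono_set
    (prod_mono Ioc_subset_Icc_self Ioc_subset_Icc_self)

theorem continuous_torusProj (c d : ℝ) : Continuous (torusProj c d) :=
  ((AddCircle.continuous_mk' c).comp continuous_fst).prodMk
    ((AddCircle.continuous_mk' d).comp continuous_snd)

theorem continuous_fderiv_apply_of_contDiff {V : ℝ × ℝ → ℝ} (hV : ContDiff ℝ (⊤ : ℕ∞) V)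
    (w : ℝ × ℝ) : Continuous fun p => fderiv ℝ V p w :=
  (hV.continuous_fderiv (by simp)).clm_apply continuous_const

theorem continuous_gradSq {V : ℝ × ℝ → ℝ} (hV : ContDiff ℝ (⊤ : ℕ∞) V) :
    Continuous (gradSq V) :=
  ((continuous_fderiv_apply_of_contDiff hV _).pow 2).add
    ((continuous_fderiv_apply_of_contDiff hV _).pow 2)

theorem hasDerivAt_fst_of_contDiff {V : ℝ × ℝ → ℝ} (hV : ContDiff ℝ (⊤ : ℕ∞) V) (x y : ℝ) :
    HasDerivAt (fun s => V (s, y)) (fderiv ℝ V (x, y) (1, 0)) x :=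
  HasFDerivAt.comp_hasDerivAt (f := fun s : ℝ => (s, y)) x
    ((hV.differentiable (by simp)) (x, y)).hasFDerivAt
    ((hasDerivAt_id x).prodMk (hasDerivAt_const x y))

theorem hasDerivAt_snd_of_contDiff {V : ℝ × ℝ → ℝ} (hV : ContDiff ℝ (⊤ : ℕ∞) V) (x y : ℝ) :
    HasDerivAt (fun s => V (x, s)) (fderiv ℝ V (x, y) (0, 1)) y :=
  HasFDerivAt.comp_hasDerivAt (f := fun s : ℝ => (x, s)) y
    ((hV.differentiable (by simp)) (x, y)).hasFDerivAt
    ((hasDerivAt_const y x).prodMk (hasDerivAt_id y))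

theorem sum_sq_of_mul_eq_zero {ι : Type*} [Fintype ι] (b : ι → ℝ)
    (hb : ∀ i j, i ≠ j → b i * b j = 0) : (∑ i, b i) ^ 2 = ∑ i, b i ^ 2 := by
  rw [sq, Finset.sum_mul_sum]
  refine Finset.sum_congr rfl fun i _ => ?_
  rw [Finset.sum_eq_single i (fun j _ hj => hb i j hj.symm) (by simp), sq]

theorem fderiv_lift_eq_zero_of_notMem_tsupport {c d : ℝ} {u : Torus c d → ℝ} {p : ℝ × ℝ}
    (hp : torusProj c d p ∉ tsupport u) :
    fderiv ℝ (fun q => u (torusProj c d q)) p = 0 := by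
  have h : (fun q => u (torusProj c d q)) =ᶠ[nhds p] fun _ => (0 : ℝ) :=
    (continuous_torusProj c d).continuousAt.eventually
      (notMem_tsupport_iff_eventuallyEq.1 hp)
  rw [h.fderiv_eq]
  simp

theorem exists_torusProj_eq {c d : ℝ} (hc : 0 < c) (hd : 0 < d) (z : Torus c d) :
    ∃ p ∈ Fund c d, torusProj c d p = z := by
  have := Fact.mk hc
  have := Fact.mk hd
  obtain ⟨x, hx, hx'⟩ := (AddCircle.coe_image_Ioc_eq c 0).symm ▸ mem_univ z.1
  obtain ⟨y, hy, hy'⟩ := (AddCircle.coe_image_Ioc_eq d 0).symm ▸ mem_univ z.2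
  exact ⟨(x, y), ⟨by simpa using hx, by simpa using hy⟩, Prod.ext hx' hy'⟩

theorem integral_sq_lift_pos {c d : ℝ} (hc : 0 < c) (hd : 0 < d) {u : Torus c d → ℝ}
    (hu : Continuous fun q => u (torusProj c d q)) (hne : u ≠ 0) :
    0 < ∫ p in Fund c d, u (torusProj c d p) ^ 2 := by
  refine lt_of_le_of_ne (integral_nonneg fun _ => sq_nonneg _) fun h => hne ?_
  have hae := (integral_eq_zero_iff_of_nonneg (fun _ => sq_nonneg _)
    (integrableOn_Fund (hu.pow 2))).1 h.symm
  have hsub : Fund c d ⊆ closure (interior (Fund c d)) := by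
    rw [Fund, interior_prod_eq, closure_prod_eq]
    exact prod_mono (Ioc_subset_closure_interior _ _) (Ioc_subset_closure_interior _ _)
  have heq := Measure.eqOn_of_ae_eq hae (hu.pow 2).continuousOn continuousOn_const hsub
  funext z
  obtain ⟨p, hp, rfl⟩ := exists_torusProj_eq hc hd z
  simpa using heq hp

/-- Among `2N` smooth functions with disjoint supports, one has Rayleigh quotient at least
`(2πN/c)²`. -/
theorem exists_le_RayleighT {c d : ℝ} (hc : 0 < c) (hd : 0 < d) {N k : ℕ} (hN : 0 < N)
    (hk : k = 2 * N) (hNcd : (N : ℝ) / c ≤ 1 / d) (u : Fin k → Torus c d → ℝ)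
    (hsm : ∀ i, ContDiff ℝ (⊤ : ℕ∞) fun q => u i (torusProj c d q)) (hne : ∀ i, u i ≠ 0)
    (hdisj : ∀ i j, i ≠ j → Disjoint (tsupport (u i)) (tsupport (u j))) :
    ∃ i, (2 * π * N / c) ^ 2 ≤ RayleighT c d (u i) := by
  set V : Fin k → ℝ × ℝ → ℝ := fun i q => u i (torusProj c d q) with hV
  have hVc : ∀ i, Continuous (V i) := fun i => (hsm i).continuous
  have hInt : ∀ i, Continuous fun x => ∫ y in (0 : ℝ)..d, V i (x, y) := fun i =>
    intervalIntegral.continuous_parametric_intervalIntegral_of_continuous'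
      (by simpa using! hVc i) _ _
  set K : ℕ → Fin k → ℂ := fun n i => ∫ x in (0 : ℝ)..c,
    Complex.exp (-(2 * π * Complex.I * n * x / c)) * ((∫ y in (0 : ℝ)..d, V i (x, y) : ℝ) : ℂ)
    with hK
  have hK0 : ∀ i, K 0 i = ((K 0 i).re : ℂ) := fun i => by
    simp [hK, intervalIntegral.integral_ofReal]
  obtain ⟨a, hsum, i₀, hi₀⟩ : ∃ a : Fin k → ℝ,
      ∑ i, a i • (((K 0 i).re, fun m => K (m + 1) i) : ℝ × (Fin (N - 1) → ℂ)) = 0 ∧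
        ∃ i, a i ≠ 0 := by
    refine Fintype.not_linearIndependent_iff.1 fun hli => ?_
    have := hli.fintype_card_le_finrank
    simp [Module.finrank_prod, Module.finrank_pi_fintype, Complex.finrank_real_complex] at this
    omega
  have hsum1 : ∑ i, a i * (K 0 i).re = 0 := by simpa [Prod.fst_sum] using congrArg Prod.fst hsum
  have hrel : ∀ n < N, ∑ i, (a i : ℂ) * K n i = 0 := by
    intro n hn
    rcases n with _ | n
    · rw [← Complex.ofReal_zero, ← hsum1, Complex.ofReal_sum]
      exact Finset.sum_congr rfl fun i _ => by rw [Complex.ofReal_mul, ← hK0 i]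
    · simpa [Prod.snd_sum] using congrFun (congrArg Prod.snd hsum) ⟨n, by omega⟩
  set v : ℝ × ℝ → ℝ := fun p => ∑ i, a i * V i p with hv
  have hvs : ContDiff ℝ (⊤ : ℕ∞) v := ContDiff.sum fun i _ => contDiff_const.mul (hsm i)
  have hfd : ∀ p w, fderiv ℝ v p w = ∑ i, a i * fderiv ℝ (V i) p w := by
    intro p w
    have hd : HasFDerivAt v (∑ i, a i • fderiv ℝ (V i) p) p :=
      HasFDerivAt.fun_sum fun i _ =>
        (((hsm i).differentiable (by simp)) p).hasFDerivAt.const_mul (a i)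
    rw [hd.fderiv]
    simp
  have hsupp : ∀ i j, i ≠ j → ∀ p, torusProj c d p ∉ tsupport (u i) ∨
      torusProj c d p ∉ tsupport (u j) := fun i j hij p => by
    by_contra! h
    exact disjoint_left.1 (hdisj i j hij) h.1 h.2
  have hv2 : ∀ p, v p ^ 2 = ∑ i, a i ^ 2 * V i p ^ 2 := fun p => by
    simp only [hv, ← mul_pow]
    refine sum_sq_of_mul_eq_zero _ fun i j hij => ?_
    rcases hsupp i j hij p with h | h <;> simp [hV, image_eq_zero_of_notMem_tsupport h]
  have hder : ∀ p w, fderiv ℝ v p w ^ 2 = ∑ i, a i ^ 2 * fderiv ℝ (V i) p w ^ 2 := fun p w => by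
    rw [hfd]
    simp only [← mul_pow]
    refine sum_sq_of_mul_eq_zero _ fun i j hij => ?_
    rcases hsupp i j hij p with h | h <;> simp [hV, fderiv_lift_eq_zero_of_notMem_tsupport h]
  have hgrad : ∀ p, gradSq v p = ∑ i, a i ^ 2 * gradSq (V i) p := fun p => by
    simp only [gradSq, hder, mul_add, Finset.sum_add_distrib]
  have hpoin := poincare_of_fourier_eq_zero hc hd hNcd (V := v)
    (hasDerivAt_fst_of_contDiff hvs) (hasDerivAt_snd_of_contDiff hvs) hvs.continuous
    (continuous_fderiv_apply_of_contDiff hvs _) (continuous_fderiv_apply_of_contDiff hvs _)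
    (fun y => by simp [hv, hV, torusProj, AddCircle.coe_period])
    (fun x => by simp [hv, hV, torusProj, AddCircle.coe_period])
    fun n hn => by
      have : ∀ x : ℝ, Complex.exp (-(2 * π * Complex.I * n * x / c)) *
          ((∫ y in (0 : ℝ)..d, v (x, y) : ℝ) : ℂ) = ∑ i, (a i : ℂ) *
          (Complex.exp (-(2 * π * Complex.I * n * x / c)) *
            ((∫ y in (0 : ℝ)..d, V i (x, y) : ℝ) : ℂ)) := by
        intro x
        simp only [hv]
        rw [intervalIntegral.integral_finsetSum fun i _ =>
          Continuous.intervalIntegrable (by fun_prop) _ _]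
        simp only [intervalIntegral.integral_const_mul, Complex.ofReal_sum, Complex.ofReal_mul,
          Finset.mul_sum]
        exact Finset.sum_congr rfl fun i _ => by ring
      simp only [this]
      rw [intervalIntegral.integral_finsetSum fun i _ =>
        Continuous.intervalIntegrable (by fun_prop) _ _]
      simp only [intervalIntegral.integral_const_mul]
      exact hrel n hn
  change _ ≤ ∫ x in (0 : ℝ)..c, ∫ y in (0 : ℝ)..d, gradSq v (x, y) at hpoin
  rw [← integral_Fund_eq hc.le hd.le (g := fun p => v p ^ 2) (by fun_prop),
    ← integral_Fund_eq hc.le hd.le (continuous_gradSq hvs)] at hpoin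
  simp only [hv2, hgrad] at hpoin
  have hgc : ∀ i, Continuous (gradSq (V i)) := fun i => continuous_gradSq (hsm i)
  rw [integral_finsetSum _ fun i _ => integrableOn_Fund (by fun_prop),
    integral_finsetSum _ fun i _ => integrableOn_Fund (by fun_prop)] at hpoin
  simp only [integral_const_mul, Finset.mul_sum] at hpoin
  by_contra! hlt
  refine absurd hpoin (not_le.2 (Finset.sum_lt_sum (fun i _ => ?_) ⟨i₀, Finset.mem_univ _, ?_⟩))
  · have := (div_lt_iff₀ (integral_sq_lift_pos hc hd (hVc i) (hne i))).1 (hlt i)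
    rw [mul_left_comm]
    exact mul_le_mul_of_nonneg_left this.le (sq_nonneg _)
  · have := (div_lt_iff₀ (integral_sq_lift_pos hc hd (hVc i₀) (hne i₀))).1 (hlt i₀)
    rw [mul_left_comm]
    exact mul_lt_mul_of_pos_left this (by positivity)

theorem bddBelow_RayleighT (c d : ℝ) (D : Set (Torus c d)) :
    BddBelow {r | ∃ u : Torus c d → ℝ, IsTest c d D u ∧ r = RayleighT c d u} := by
  refine ⟨0, ?_⟩
  rintro _ ⟨u, -, rfl⟩
  exact div_nonneg (integral_nonneg fun _ => add_nonneg (sq_nonneg _) (sq_nonneg _))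
    (integral_nonneg fun _ => sq_nonneg _)

theorem contDiff_re_toCircle_sub {T : ℝ} (z : AddCircle T) :
    ContDiff ℝ (⊤ : ℕ∞) fun x : ℝ => (AddCircle.toCircle ((x : AddCircle T) - z) : ℂ).re := by
  induction z using QuotientAddGroup.induction_on with
  | H t =>
    have : ∀ x : ℝ, (AddCircle.toCircle ((x : AddCircle T) - (t : AddCircle T)) : ℂ).re =
        cos (2 * π / T * (x - t)) := fun x => by
      rw [← AddCircle.coe_sub, AddCircle.toCircle_apply_mk, Circle.coe_exp,
        Complex.exp_ofReal_mul_I_re]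
    simp only [this]
    fun_prop

theorem re_toCircle_lt_one {T : ℝ} (hT : T ≠ 0) {z : AddCircle T} (hz : z ≠ 0) :
    (AddCircle.toCircle z : ℂ).re < 1 := by
  set w := AddCircle.toCircle z with hw
  have hn : (w : ℂ).re ^ 2 + (w : ℂ).im ^ 2 = 1 := by
    have := Circle.normSq_coe w
    rw [Complex.normSq_apply] at this
    linarith
  by_contra! h
  refine hz (AddCircle.injective_toCircle hT ?_)
  rw [← hw, AddCircle.toCircle_zero]
  apply Circle.ext
  have h1 : (w : ℂ).re = 1 := by nlinarith [sq_nonneg (w : ℂ).im]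
  apply Complex.ext <;> simp
  · exact h1
  · rw [h1] at hn; simpa using hn

/-- Every nonempty open subset of the torus supports a test function. -/
theorem exists_isTest {c d : ℝ} (hc : 0 < c) (hd : 0 < d) {D : Set (Torus c d)}
    (hD : IsOpen D) (hne : D.Nonempty) : ∃ u, IsTest c d D u := by
  have := Fact.mk hc
  have := Fact.mk hd
  obtain ⟨z₀, hz₀⟩ := hne
  set h : Torus c d → ℝ := fun z => (AddCircle.toCircle (z.1 - z₀.1) : ℂ).re +
    (AddCircle.toCircle (z.2 - z₀.2) : ℂ).re with hh
  have hcont : Continuous h := by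
    have h1 : Continuous fun z : Torus c d => (AddCircle.toCircle (z.1 - z₀.1) : ℂ) :=
      (continuous_induced_dom (f := ((↑) : Circle → ℂ))).comp (AddCircle.continuous_toCircle.comp (by fun_prop))
    have h2 : Continuous fun z : Torus c d => (AddCircle.toCircle (z.2 - z₀.2) : ℂ) :=
      (continuous_induced_dom (f := ((↑) : Circle → ℂ))).comp (AddCircle.continuous_toCircle.comp (by fun_prop))
    exact (Complex.continuous_re.comp h1).add (Complex.continuous_re.comp h2)
  have hle : ∀ {T : ℝ} (z : AddCircle T), (AddCircle.toCircle z : ℂ).re ≤ 1 := fun z =>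
    (Complex.re_le_norm _).trans (Circle.norm_coe _).le
  have hlt : ∀ z, z ≠ z₀ → h z < 2 := by
    intro z hz
    rcases not_and_or.1 (fun h => hz (Prod.ext_iff.2 h)) with h' | h'
    · have := re_toCircle_lt_one hc.ne' (sub_ne_zero.2 h')
      simp only [hh]; linarith [hle (z.2 - z₀.2)]
    · have := re_toCircle_lt_one hd.ne' (sub_ne_zero.2 h')
      simp only [hh]; linarith [hle (z.1 - z₀.1)]
  have hz₀2 : h z₀ = 2 := by simp [hh]; norm_num
  obtain ⟨m, hm2, hm⟩ : ∃ m < 2, ∀ z, m ≤ h z → z ∈ D := by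
    rcases Dᶜ.eq_empty_or_nonempty with he | hne
    · exact ⟨0, by norm_num, fun z _ => by
        by_contra hz; exact (he ▸ (show z ∈ Dᶜ from hz) : z ∈ (∅ : Set (Torus c d)))⟩
    · obtain ⟨z₁, hz₁, hmax⟩ := hD.isClosed_compl.isCompact.exists_isMaxOn hne hcont.continuousOn
      have := hlt z₁ fun h => hz₁ (h ▸ hz₀)
      refine ⟨(h z₁ + 2) / 2, by linarith, fun z hz => ?_⟩
      by_contra hzD
      have : h z ≤ h z₁ := hmax (show z ∈ Dᶜ from hzD)
      linarith
  refine ⟨fun z => expNegInvGlue (h z - m), ?_, fun h0 => ?_, (isClosed_tsupport _).isCompact, ?_⟩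
  · refine expNegInvGlue.contDiff.comp (ContDiff.sub (ContDiff.add ?_ ?_) contDiff_const)
    · exact (contDiff_re_toCircle_sub z₀.1).comp contDiff_fst
    · exact (contDiff_re_toCircle_sub z₀.2).comp contDiff_snd
  · have := congrFun h0 z₀
    simp only [hz₀2, Pi.zero_apply, expNegInvGlue.zero_iff_nonpos] at this
    linarith
  · have hcl : IsClosed {z | m ≤ h z} := isClosed_le continuous_const hcont
    refine (closure_minimal (fun z hz => ?_) hcl).trans hm
    by_contra hlt
    exact hz (expNegInvGlue.zero_of_nonpos (by simp only [mem_ofPred_eq, not_le] at hlt; linarith))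

/-- A smooth `1`-Lipschitz approximation of the positive part, vanishing on `(-∞, ε]`. -/
theorem exists_smooth_truncation {ε : ℝ} (hε : 0 < ε) :
    ∃ F : ℝ → ℝ, ContDiff ℝ (⊤ : ℕ∞) F ∧ (∀ t ≤ ε, F t = 0) ∧ (∀ t, 0 ≤ F t) ∧
      (∀ t, deriv F t ^ 2 ≤ 1) ∧ ∀ t, t - 2 * ε ≤ F t := by
  set ψ : ℝ → ℝ := fun τ => smoothTransition ((τ - ε) / ε) with hψ
  have hψs : ContDiff ℝ (⊤ : ℕ∞) ψ :=
    smoothTransition.contDiff.comp ((contDiff_id.sub contDiff_const).div_const _)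
  have hψ0 : ∀ τ, 0 ≤ ψ τ := fun τ => smoothTransition.nonneg _
  have hψi : ∀ a b, IntervalIntegrable ψ volume a b := fun a b =>
    hψs.continuous.intervalIntegrable _ _
  have hder : ∀ t, HasDerivAt (fun t => ∫ τ in (ε)..t, ψ τ) (ψ t) t := fun t =>
    intervalIntegral.integral_hasDerivAt_right (hψi _ _)
      (hψs.continuous.stronglyMeasurableAtFilter _ _) hψs.continuous.continuousAt
  have hderiv : deriv (fun t => ∫ τ in (ε)..t, ψ τ) = ψ := funext fun t => (hder t).deriv
  have hzero : ∀ t ≤ ε, ∫ τ in (ε)..t, ψ τ = 0 := by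
    intro t ht
    rw [intervalIntegral.integral_congr (g := fun _ => (0 : ℝ)) (fun τ hτ => ?_)]
    · simp
    · rw [uIcc_of_ge ht] at hτ
      exact smoothTransition.zero_of_nonpos (div_nonpos_of_nonpos_of_nonneg
        (by linarith [hτ.2]) hε.le)
  have hnn : ∀ t, 0 ≤ ∫ τ in (ε)..t, ψ τ := by
    intro t
    rcases le_total t ε with ht | ht
    · exact (hzero t ht).ge
    · exact intervalIntegral.integral_nonneg ht fun τ _ => hψ0 τ
  refine ⟨fun t => ∫ τ in (ε)..t, ψ τ, ?_, hzero, hnn, fun t => ?_, fun t => ?_⟩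
  · exact contDiff_infty_iff_deriv.2 ⟨fun t => (hder t).differentiableAt, by rwa [hderiv]⟩
  · rw [hderiv]
    exact pow_le_one₀ (hψ0 t) (smoothTransition.le_one _)
  · rcases le_total t (2 * ε) with ht | ht
    · exact le_trans (by linarith) (hnn t)
    · have h1 : ∫ τ in (2 * ε)..t, ψ τ = t - 2 * ε := by
        rw [intervalIntegral.integral_congr (g := fun _ => (1 : ℝ)) (fun τ hτ => ?_)]
        · simp
        · rw [uIcc_of_le ht] at hτ
          exact smoothTransition.one_of_one_le ((one_le_div hε).2 (by linarith [hτ.1]))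
      have := intervalIntegral.integral_add_adjacent_intervals (hψi ε (2 * ε)) (hψi (2 * ε) t)
      have := hnn (2 * ε)
      dsimp only at *
      linarith

/-- The vertical strip `(a, b) × (ℝ/dℤ)` of the torus `T(c,d)`. -/
def verticalStrip (c d a b : ℝ) : Set (Torus c d) :=
  {z | ∃ x : ℝ, (x : AddCircle c) = z.1 ∧ a < x ∧ x < b}

theorem setIntegral_Fund_indicator {a b c d : ℝ} (hd : 0 < d) (ha : 0 ≤ a)
    (hab : a ≤ b) (hb : b ≤ c) {f : ℝ → ℝ} (hf : Continuous f) :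
    IntegrableOn (fun p : ℝ × ℝ => (Ioo a b).indicator f p.1) (Fund c d) ∧
    ∫ p in Fund c d, (Ioo a b).indicator f p.1 = d * ∫ x in a..b, f x := by
  have hInt : IntegrableOn ((Ioo a b).indicator f) (Ioc 0 c) :=
    (hf.integrableOn_Ioc).indicator measurableSet_Ioo
  constructor
  · rw [Fund, IntegrableOn, Measure.volume_eq_prod, ← Measure.prod_restrict]
    exact Integrable.comp_fst hInt _
  · rw [Fund, Measure.volume_eq_prod, ← Measure.prod_restrict, integral_fun_fst,
      setIntegral_indicator measurableSet_Ioo, intervalIntegral.integral_of_le hab,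
      integral_Ioc_eq_integral_Ioo]
    have : Ioc 0 c ∩ Ioo a b = Ioo a b :=
      inter_eq_right.2 fun x hx => ⟨by linarith [hx.1], by linarith [hx.2]⟩
    rw [this]
    simp [hd.le]

theorem integral_trig_half_period {a b : ℝ} (hab : a < b) :
    (∫ x in a..b, sin (π / (b - a) * x - π / (b - a) * a) ^ 2) = (b - a) / 2 ∧
    (∫ x in a..b, cos (π / (b - a) * x - π / (b - a) * a) ^ 2) = (b - a) / 2 := by
  have hL : 0 < b - a := sub_pos.2 hab
  have hw : π / (b - a) ≠ 0 := (div_pos pi_pos hL).ne'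
  have hb : π / (b - a) * b - π / (b - a) * a = π := by field_simp
  have hpi := pi_ne_zero
  constructor
  · rw [intervalIntegral.integral_comp_mul_sub (fun t => sin t ^ 2) hw, sub_self, hb,
      integral_sin_sq]
    simp
    field_simp
  · rw [intervalIntegral.integral_comp_mul_sub (fun t => cos t ^ 2) hw, sub_self, hb,
      integral_cos_sq]
    simp
    field_simp

theorem exists_test_verticalStrip {a b c d : ℝ} (hc : 0 < c) (hd : 0 < d) (ha : 0 ≤ a)
    (hab : a < b) (hb : b ≤ c) {ε : ℝ} (hε : 0 < ε) (hε1 : ε < 1 / 8) :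
    ∃ u, IsTest c d (verticalStrip c d a b) u ∧
      RayleighT c d u ≤ (π / (b - a)) ^ 2 / (1 - 8 * ε) := by
  have := Fact.mk hc
  have := Fact.mk hd
  obtain ⟨F, hFs, hF0, hFnn, hF1, hFge⟩ := exists_smooth_truncation hε
  have hL : 0 < b - a := sub_pos.2 hab
  set w := π / (b - a) with hw
  have hw0 : 0 < w := div_pos pi_pos hL
  have hwL : w * (b - a) = π := by rw [hw]; field_simp
  set s : ℝ → ℝ := fun x => sin (w * x - w * a) with hs
  have hsd : ∀ x, HasDerivAt s (cos (w * x - w * a) * w) x := fun x => by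
    have h : HasDerivAt (fun x => w * x - w * a) w x := by
      simpa using ((hasDerivAt_id x).const_mul w).sub_const (w * a)
    exact h.sin
  have hFsc : ContDiff ℝ (⊤ : ℕ∞) fun x => F (s x) := hFs.comp (by fun_prop)
  have hsmall : ∀ x ∈ Ioo a b, x ∉ Icc (a + ε / w) (b - ε / w) → F (s x) = 0 := by
    intro x hx hx'
    apply hF0
    rcases not_and_or.1 hx' with h | h
    · have h1 : 0 ≤ w * x - w * a := by nlinarith [hx.1]
      refine (sin_le h1).trans ?_
      have : (x - a) < ε / w := by linarith
      rw [lt_div_iff₀ hw0] at this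
      linarith
    · have h1 : 0 ≤ π - (w * x - w * a) := by rw [← hwL]; nlinarith [hx.2]
      simp only [hs]
      rw [← sin_pi_sub]
      refine (sin_le h1).trans ?_
      have : (b - x) < ε / w := by linarith
      rw [lt_div_iff₀ hw0] at this
      rw [← hwL]
      linarith
  have hsub : Icc (a + ε / w) (b - ε / w) ⊆ Ioo a b := fun x hx => by
    have : 0 < ε / w := div_pos hε hw0
    exact ⟨by linarith [hx.1], by linarith [hx.2]⟩
  have hIoc : ∀ x ∈ Ioo a b, x ∈ Ioc 0 (0 + c) := fun x hx =>
    ⟨by linarith [hx.1], by linarith [hx.2]⟩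
  set K : Set (AddCircle c) := (fun x : ℝ => (x : AddCircle c)) '' Icc (a + ε / w) (b - ε / w)
    with hK
  have hKc : IsClosed K := (isCompact_Icc.image (AddCircle.continuous_mk' c)).isClosed
  set g : AddCircle c → ℝ := AddCircle.liftIoc c 0 ((Ioo a b).indicator fun x => F (s x)) with hg
  have hgin : ∀ x ∈ Ioo a b, g x = F (s x) := fun x hx => by
    rw [hg, AddCircle.liftIoc_coe_apply (hIoc x hx), indicator_of_mem hx]
  have hgout : ∀ z ∉ K, g z = 0 := by
    intro z hz
    obtain ⟨x, hx, rfl⟩ := (AddCircle.coe_image_Ioc_eq c 0).symm ▸ mem_univ z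
    rw [hg, AddCircle.liftIoc_coe_apply hx]
    refine indicator_apply_eq_zero.2 fun hx' => hsmall x hx' fun h => hz ⟨x, h, rfl⟩
  set u : Torus c d → ℝ := fun z => g z.1 with hu
  have hsupp : tsupport u ⊆ Prod.fst ⁻¹' K := by
    refine closure_minimal (fun z hz => ?_) (hKc.preimage continuous_fst)
    by_contra h
    exact hz (hgout _ h)
  have hnear : ∀ p : ℝ × ℝ, p.1 ∈ Ioo a b →
      (fun q => u (torusProj c d q)) =ᶠ[nhds p] fun q => F (s q.1) := fun p hp =>
    (continuous_fst.continuousAt.eventually (isOpen_Ioo.mem_nhds hp)).mono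
      fun q hq => hgin q.1 hq
  have hsm : ContDiff ℝ (⊤ : ℕ∞) fun q => u (torusProj c d q) := by
    refine contDiff_iff_contDiffAt.2 fun p => ?_
    by_cases hp : torusProj c d p ∈ tsupport u
    · obtain ⟨y, hy, hyp⟩ := hsupp hp
      obtain ⟨n, hn⟩ := (AddCircle.coe_eq_zero_iff c).1
        (show ((p.1 - y : ℝ) : AddCircle c) = 0 by
          rw [AddCircle.coe_sub, sub_eq_zero]; exact hyp.symm)
      have hshift : ∀ q : ℝ × ℝ,
          u (torusProj c d q) = u (torusProj c d (q.1 - n • c, q.2)) := fun q => by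
        simp [hu, torusProj, AddCircle.coe_period]
      have hF : ContDiff ℝ (⊤ : ℕ∞) fun q : ℝ × ℝ => F (s (q.1 - n • c)) :=
        hFsc.comp (contDiff_fst.sub contDiff_const)
      refine hF.contDiffAt.congr_of_eventuallyEq ?_
      have hmem : p.1 - n • c ∈ Ioo a b := by
        rw [hn, sub_sub_cancel]; exact hsub hy
      have hc' : Continuous fun q : ℝ × ℝ => q.1 - n • c := by fun_prop
      filter_upwards [hc'.continuousAt.eventually (isOpen_Ioo.mem_nhds hmem)] with q hq
      rw [hshift]
      exact hgin _ hq
    · have h : (fun q => u (torusProj c d q)) =ᶠ[nhds p] fun _ => (0 : ℝ) :=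
        (continuous_torusProj c d).continuousAt.eventually
          (notMem_tsupport_iff_eventuallyEq.1 hp)
      exact contDiffAt_const.congr_of_eventuallyEq h
  have hne : u ≠ 0 := by
    intro h0
    have hmid : (a + b) / 2 ∈ Ioo a b := ⟨by linarith, by linarith⟩
    have h1 : u (((a + b) / 2 : ℝ), 0) = F (s ((a + b) / 2)) := hgin _ hmid
    have h2 : s ((a + b) / 2) = 1 := by
      simp only [hs]
      rw [← sin_pi_div_two, ← hwL]
      congr 1; ring
    rw [h0, h2] at h1
    have := hFge 1
    simp only [Pi.zero_apply] at h1
    linarith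
  refine ⟨u, ⟨hsm, hne, (isClosed_tsupport _).isCompact, fun z hz => ?_⟩, ?_⟩
  · obtain ⟨x, hx, hxz⟩ := hsupp hz
    exact ⟨x, hxz, (hsub hx).1, (hsub hx).2⟩
  have hmeas : MeasurableSet (Fund c d) := measurableSet_Ioc.prod measurableSet_Ioc
  obtain ⟨hsin, hcos⟩ := integral_trig_half_period hab
  rw [← hw] at hsin hcos
  obtain ⟨hni, hnv⟩ := setIntegral_Fund_indicator hd ha hab.le hb
    (f := fun x => w ^ 2 * cos (w * x - w * a) ^ 2) (by fun_prop)
  obtain ⟨hdi, hdv⟩ := setIntegral_Fund_indicator hd ha hab.le hb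
    (f := fun x => s x ^ 2 - 4 * ε) (by fun_prop)
  have hnum : ∫ p in Fund c d, gradSq (fun q => u (torusProj c d q)) p ≤
      w ^ 2 * (d * ((b - a) / 2)) := by
    calc _ ≤ ∫ p in Fund c d,
          (Ioo a b).indicator (fun x => w ^ 2 * cos (w * x - w * a) ^ 2) p.1 := by
          refine setIntegral_mono_on (integrableOn_Fund (continuous_gradSq hsm)) hni hmeas
            fun p hp => ?_
          by_cases hpab : p.1 ∈ Ioo a b
          · rw [indicator_of_mem hpab, gradSq, (hnear p hpab).fderiv_eq]
            have hder : HasFDerivAt (fun q : ℝ × ℝ => F (s q.1))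
                ((deriv F (s p.1) * (cos (w * p.1 - w * a) * w)) •
                  ContinuousLinearMap.fst ℝ ℝ ℝ) p :=
              HasDerivAt.comp_hasFDerivAt (h₂ := fun x => F (s x)) p
                (((hFs.differentiable (by simp)) (s p.1)).hasDerivAt.comp p.1 (hsd p.1))
                hasFDerivAt_fst
            rw [hder.fderiv]
            have := hF1 (s p.1)
            simp
            rw [mul_pow, mul_pow, mul_comm (w ^ 2)]
            exact mul_le_of_le_one_left (by positivity) this
          · rw [indicator_of_notMem hpab, gradSq, fderiv_lift_eq_zero_of_notMem_tsupport]
            · simp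
            · intro hp'
              obtain ⟨y, hy, hyp⟩ := hsupp hp'
              have : y = p.1 := (AddCircle.coe_eq_coe_iff_of_mem_Ioc (p := c) (a := 0)
                (hIoc y (hsub hy)) (by simpa using hp.1)).1 hyp
              exact hpab (this ▸ hsub hy)
      _ = _ := by
          rw [hnv, intervalIntegral.integral_const_mul, hcos]; ring
  have hden : d * ((b - a) / 2 * (1 - 8 * ε)) ≤ ∫ p in Fund c d, u (torusProj c d p) ^ 2 := by
    calc _ = ∫ p in Fund c d, (Ioo a b).indicator (fun x => s x ^ 2 - 4 * ε) p.1 := by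
          rw [hdv, intervalIntegral.integral_sub (Continuous.intervalIntegrable (by fun_prop) _ _)
            intervalIntegrable_const, hsin, intervalIntegral.integral_const, smul_eq_mul]
          ring
      _ ≤ _ := by
          refine setIntegral_mono_on hdi (integrableOn_Fund (hsm.continuous.pow 2)) hmeas
            fun p _ => ?_
          by_cases hpab : p.1 ∈ Ioo a b
          · rw [indicator_of_mem hpab, show u (torusProj c d p) = F (s p.1) from hgin _ hpab]
            have h1 := hFge (s p.1)
            have h2 := hFnn (s p.1)
            have h3 : s p.1 ≤ 1 := sin_le_one _
            have h4 : -1 ≤ s p.1 := neg_one_le_sin _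
            rcases le_total (s p.1) (2 * ε) with h | h
            · have h5 : 0 ≤ s p.1 := by
                refine sin_nonneg_of_nonneg_of_le_pi ?_ ?_
                · nlinarith [hpab.1]
                · rw [← hwL]; nlinarith [hpab.2]
              nlinarith
            · nlinarith
          · rw [indicator_of_notMem hpab]; positivity
  have hpos : 0 < d * ((b - a) / 2 * (1 - 8 * ε)) := by
    have : 0 < 1 - 8 * ε := by linarith
    positivity
  rw [RayleighT]
  calc _ ≤ w ^ 2 * (d * ((b - a) / 2)) / (d * ((b - a) / 2 * (1 - 8 * ε))) :=
        div_le_div₀ (by positivity) hnum hpos hden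
    _ = _ := by
        have : 1 - 8 * ε ≠ 0 := by linarith
        field_simp

theorem groundEnergy_verticalStrip_le {a b c d : ℝ} (hc : 0 < c) (hd : 0 < d) (ha : 0 ≤ a)
    (hab : a < b) (hb : b ≤ c) :
    groundEnergy c d (verticalStrip c d a b) ≤ (π / (b - a)) ^ 2 := by
  have hlim : Filter.Tendsto (fun ε : ℝ => (π / (b - a)) ^ 2 / (1 - 8 * ε))
      (nhdsWithin 0 (Ioi 0)) (nhds ((π / (b - a)) ^ 2)) := by
    have : ContinuousAt (fun ε : ℝ => (π / (b - a)) ^ 2 / (1 - 8 * ε)) 0 :=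
      continuousAt_const.div (by fun_prop) (by norm_num)
    simpa [ContinuousAt] using! this.tendsto.mono_left nhdsWithin_le_nhds
  refine ge_of_tendsto hlim ?_
  filter_upwards [Ioo_mem_nhdsGT (show (0 : ℝ) < 1 / 8 by norm_num)] with ε hε
  obtain ⟨u, hu, hle⟩ := exists_test_verticalStrip hc hd ha hab hb hε.1 hε.2
  exact (csInf_le (bddBelow_RayleighT c d _) ⟨u, hu, rfl⟩).trans hle

theorem isPartitionT_stripPartitionCD {c : ℝ} (d : ℝ) (hc : 0 < c) {k : ℕ} (hk : 1 ≤ k) :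
    IsPartitionT c d (stripPartitionCD c d k) := by
  have := Fact.mk hc
  have hk0 : (0 : ℝ) < k := by exact_mod_cast hk
  have hstep : 0 < c / k := div_pos hc hk0
  have hmem : ∀ (i : Fin k) (x : ℝ), ((i : ℕ) : ℝ) * c / k < x →
      x < (((i : ℕ) : ℝ) + 1) * c / k → x ∈ Ioc 0 (0 + c) := by
    intro i x h1 h2
    have h3 : (0 : ℝ) ≤ ((i : ℕ) : ℝ) * c / k := by positivity
    have h4 : (((i : ℕ) : ℝ) + 1) * c / k ≤ c := by
      rw [div_le_iff₀ hk0, mul_comm c]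
      gcongr
      exact_mod_cast i.2
    exact ⟨by linarith, by linarith⟩
  refine ⟨fun i => ?_, fun i => ?_, fun i j hij => ?_⟩
  · have : stripPartitionCD c d k i = Prod.fst ⁻¹' ((fun x : ℝ => (x : AddCircle c)) ''
        Ioo (((i : ℕ) : ℝ) * c / k) ((((i : ℕ) : ℝ) + 1) * c / k)) := by
      ext z
      constructor
      · rintro ⟨x, h, h1, h2⟩
        exact ⟨x, ⟨h1, h2⟩, h⟩
      · rintro ⟨x, ⟨h1, h2⟩, h⟩
        exact ⟨x, h, h1, h2⟩
    rw [this]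
    exact (QuotientAddGroup.isOpenMap_coe _ isOpen_Ioo).preimage continuous_fst
  · refine ⟨((((((i : ℕ) : ℝ) + 1 / 2) * c / k : ℝ) : AddCircle c), 0), _, rfl, ?_, ?_⟩ <;>
      gcongr <;> norm_num
  · refine disjoint_left.2 ?_
    rintro z ⟨x, hx, h1, h2⟩ ⟨y, hy, h3, h4⟩
    obtain rfl : x = y := (AddCircle.coe_eq_coe_iff_of_mem_Ioc (hmem i x h1 h2)
      (hmem j y h3 h4)).1 (hx.trans hy.symm)
    refine hij (Fin.ext ?_)
    have key : ∀ m n : ℕ, (m : ℝ) * c / k < x → x < ((n : ℝ) + 1) * c / k → m ≤ n := by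
      intro m n hm hn
      have := hm.trans hn
      rw [div_lt_div_iff_of_pos_right hk0, mul_lt_mul_iff_left₀ hc] at this
      exact Nat.lt_succ_iff.1 (by exact_mod_cast this)
    exact le_antisymm (key _ _ h1 h4) (key _ _ h3 h2)

theorem energyT_stripPartitionCD_le {c d : ℝ} (hc : 0 < c) (hd : 0 < d) {k : ℕ} (hk : 1 ≤ k) :
    energyT c d (stripPartitionCD c d k) ≤ π ^ 2 * (k : ℝ) ^ 2 / c ^ 2 := by
  have hk0 : (0 : ℝ) < k := by exact_mod_cast hk
  have : Nonempty (Fin k) := ⟨⟨0, hk⟩⟩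
  refine ciSup_le fun i => ?_
  have h4 : (((i : ℕ) : ℝ) + 1) * c / k ≤ c := by
    rw [div_le_iff₀ hk0, mul_comm c]
    gcongr
    exact_mod_cast i.2
  refine (groundEnergy_verticalStrip_le hc hd (by positivity) ?_ h4).trans_eq ?_
  · gcongr; norm_num
  · rw [show (((i : ℕ) : ℝ) + 1) * c / k - ((i : ℕ) : ℝ) * c / k = c / k by ring]
    field_simp

/-- Every partition of the torus into `2N` sets has energy at least `(2πN/c)²`. -/
theorem le_energyT {c d : ℝ} (hc : 0 < c) (hd : 0 < d) {N k : ℕ} (hN : 0 < N)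
    (hk : k = 2 * N) (hNcd : (N : ℝ) / c ≤ 1 / d) {D : Fin k → Set (Torus c d)}
    (hD : IsPartitionT c d D) : (2 * π * N / c) ^ 2 ≤ energyT c d D := by
  by_contra! hlt
  have hi : ∀ i, ∃ u, IsTest c d (D i) u ∧ RayleighT c d u < (2 * π * N / c) ^ 2 := by
    intro i
    obtain ⟨u₀, hu₀⟩ := exists_isTest hc hd (hD.1 i) (hD.2.1 i)
    have h : groundEnergy c d (D i) < (2 * π * N / c) ^ 2 :=
      (le_ciSup (f := fun i => groundEnergy c d (D i)) (finite_range _).bddAbove i).trans_lt hlt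
    have hne : {r | ∃ u, IsTest c d (D i) u ∧ r = RayleighT c d u}.Nonempty :=
      ⟨_, u₀, hu₀, rfl⟩
    obtain ⟨_, ⟨u, hu, rfl⟩, hr⟩ := exists_lt_of_csInf_lt hne h
    exact ⟨u, hu, hr⟩
  choose u hu hr using hi
  obtain ⟨i, h⟩ := exists_le_RayleighT hc hd hN hk hNcd u (fun i => (hu i).1)
    (fun i => (hu i).2.1)
    fun i j hij => (hD.2.2 i j hij).mono (hu i).2.2.2 (hu j).2.2.2
  exact absurd h (not_le.2 (hr i))

/-- Let `c > d > 0` and let `k ≥ 1` be even with `k < 2c/d`. Then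
`𝔏_k(T(c,d)) = π²k²/c²`, attained by the nodal partition of `(x,y) ↦ sin(πkx/c)`, i.e. by
the partition of `T(c,d)` into `k` vertical strips. -/
theorem statement16 (c d : ℝ) (hd : 0 < d) (hdc : d < c) (k : ℕ) (hk : 1 ≤ k)
    (hke : Even k) (hkcd : (k : ℝ) < 2 * c / d) :
    minEnergyT c d k = π ^ 2 * (k : ℝ) ^ 2 / c ^ 2 ∧
    IsPartitionT c d (stripPartitionCD c d k) ∧
    energyT c d (stripPartitionCD c d k) = π ^ 2 * (k : ℝ) ^ 2 / c ^ 2 := by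
  have hc : 0 < c := hd.trans hdc
  obtain ⟨N, hN⟩ := hke
  have hk2 : k = 2 * N := by omega
  have hNcd : (N : ℝ) / c ≤ 1 / d := by
    rw [hk2, lt_div_iff₀ hd] at hkcd
    push_cast at hkcd
    rw [div_le_div_iff₀ hc hd]
    linarith
  have hμ : (2 * π * N / c) ^ 2 = π ^ 2 * (k : ℝ) ^ 2 / c ^ 2 := by
    rw [hk2]; push_cast; ring
  have hlow : ∀ D : Fin k → Set (Torus c d), IsPartitionT c d D →
      π ^ 2 * (k : ℝ) ^ 2 / c ^ 2 ≤ energyT c d D := fun D hD =>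
    hμ ▸ le_energyT hc hd (by omega) hk2 hNcd hD
  have hP := isPartitionT_stripPartitionCD d hc hk
  have hE : energyT c d (stripPartitionCD c d k) = π ^ 2 * (k : ℝ) ^ 2 / c ^ 2 :=
    le_antisymm (energyT_stripPartitionCD_le hc hd hk) (hlow _ hP)
  have hleast : IsLeast {E | ∃ D : Fin k → Set (Torus c d), IsPartitionT c d D ∧
      E = energyT c d D} (π ^ 2 * (k : ℝ) ^ 2 / c ^ 2) := by
    refine ⟨⟨_, hP, hE.symm⟩, ?_⟩
    rintro _ ⟨D, hD, rfl⟩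
    exact hlow D hD
  exact ⟨hleast.csInf_eq, hP, hE⟩
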